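/- arXiv:2411.19606 — 2 statements merged into one kernel-verified Lean document; each statement's English description precedes it below -/
import Mathlib

section
/- Fix an integer n > 1. For every finite coloring of ℕ, there exist natural numbers a and b (with a, b ≥ 1) such that a, b, and a·n^b all receive the same color. -/
open Combinatorics in
/-- **Van der Waerden's theorem** with a bound on the progression: there is `W` such that every
coloring has a monochromatic progression of length `L + 1` with step and terms at most `W`. -/
theorem exists_bound_mono_arithmetic_progression (κ : Type*) [Finite κ] (L : ℕ) :
    ∃ W : ℕ, ∀ C : ℕ → κ, ∃ s b : ℕ, 1 ≤ s ∧ s ≤ W ∧ b + s * L ≤ W ∧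
      ∃ k, ∀ i ≤ L, C (b + s * i) = k := by
  classical
  obtain ⟨ι, _, hι⟩ := Line.exists_mono_in_high_dimension (Fin (L + 1)) κ
  refine ⟨Fintype.card ι * (L + 1), fun C ↦ ?_⟩
  obtain ⟨l, k, hl⟩ := hι fun v ↦ C (∑ i, (v i : ℕ))
  obtain ⟨i₀, hi₀⟩ := l.proper
  set A : Finset ι := {i | l.idxFun i = none} with hA
  set b : ℕ := ∑ i ∈ Aᶜ, ((l 0 i : Fin (L + 1)) : ℕ)
  have sum_line (x : Fin (L + 1)) : ∑ i, (l x i : ℕ) = b + A.card * x := by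
    rw [← Finset.sum_add_sum_compl A, add_comm]
    congr 1
    · refine Finset.sum_congr rfl fun i hi ↦ ?_
      have hne : l.idxFun i ≠ none := by simpa [hA] using hi
      obtain ⟨y, hy⟩ := Option.ne_none_iff_exists'.mp hne
      rw [l.apply_some hy, l.apply_some hy]
    · rw [← smul_eq_mul, ← Finset.sum_const]
      refine Finset.sum_congr rfl fun i hi ↦ ?_
      rw [l.apply_none x i (by simpa [hA] using hi)]
  have sum_le : b + A.card * L ≤ Fintype.card ι * (L + 1) := by
    have h := sum_line (Fin.last L)
    rw [Fin.val_last] at h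
    rw [← h, ← smul_eq_mul, ← Finset.card_univ, ← Finset.sum_const]
    exact Finset.sum_le_sum fun i _ ↦ (Fin.is_lt _).le
  refine ⟨A.card, b, Finset.card_pos.mpr ⟨i₀, by simpa [hA] using hi₀⟩,
    (Finset.card_le_univ A).trans (Nat.le_mul_of_pos_right _ L.succ_pos),
    sum_le, k, fun i hi ↦ ?_⟩
  exact (congrArg C (sum_line ⟨i, Nat.lt_succ_of_le hi⟩)).symm.trans (hl _)

/-- The colors in `S` are avoided by arbitrarily long initial segments of multiples. -/
def AvoidsHomogeneousProgressions {κ : Type*} (c : ℕ → κ) (S : Finset κ) : Prop :=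
  ∀ L : ℕ, ∃ d : ℕ, 1 ≤ d ∧ ∀ i, 1 ≤ i → i ≤ L → c (d * i) ∉ S

/-- Absent a monochromatic triple `a, b, a * n ^ b`, a set of colors avoided by arbitrarily long
initial segments of multiples can be enlarged. -/
theorem AvoidsHomogeneousProgressions.exists_insert {κ : Type*} [Finite κ] [DecidableEq κ]
    {n : ℕ} (hn : 1 ≤ n) {c : ℕ → κ}
    (hc : ∀ a b : ℕ, 1 ≤ a → 1 ≤ b → c a = c b → c a ≠ c (a * n ^ b))
    {S : Finset κ} (hS : AvoidsHomogeneousProgressions c S) :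
    ∃ k ∉ S, AvoidsHomogeneousProgressions c (insert k S) := by
  have step (L : ℕ) : ∃ k ∉ S, ∃ d : ℕ, 1 ≤ d ∧
      ∀ i, 1 ≤ i → i ≤ L → c (d * i) ∉ insert k S := by
    obtain ⟨W, hW⟩ := exists_bound_mono_arithmetic_progression κ L
    obtain ⟨d, hd, hdS⟩ := hS (W * L)
    obtain ⟨D, hD, hDS⟩ := hS (n ^ (d * W))
    obtain ⟨s, b, hs, hsW, hbW, k, hk⟩ := hW fun i ↦ c (D * n ^ (d * i))
    have hk₀ : c (D * n ^ (d * b)) = k := by simpa using hk 0 L.zero_le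
    have pos (m : ℕ) : 1 ≤ n ^ m := Nat.one_le_pow _ _ hn
    refine ⟨k, ?_, d * s, Nat.mul_pos hd hs, fun i hi hiL hmem ↦ ?_⟩
    · rw [← hk₀]
      exact hDS _ (pos _) (Nat.pow_le_pow_right hn (Nat.mul_le_mul_left d (le_of_add_le_left hbW)))
    · rcases Finset.mem_insert.mp hmem with h | h
      · refine hc (D * n ^ (d * b)) (d * s * i) (Nat.mul_pos hD (pos _))
          (Nat.mul_pos (Nat.mul_pos hd hs) hi) (hk₀.trans h.symm) ?_
        rw [hk₀, ← hk i hiL, mul_assoc D, ← pow_add, mul_assoc d, ← mul_add]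
      · rw [mul_assoc] at h
        exact hdS _ (Nat.mul_pos hs hi) (Nat.mul_le_mul hsW hiL) h
  cases nonempty_fintype κ
  by_contra! hcon
  have bad (k : κ) : ∃ L : ℕ, k ∉ S → ∀ d : ℕ, 1 ≤ d →
      ∃ i, 1 ≤ i ∧ i ≤ L ∧ c (d * i) ∈ insert k S := by
    by_cases hk : k ∈ S
    · exact ⟨0, fun h ↦ absurd hk h⟩
    · have h := hcon k hk
      unfold AvoidsHomogeneousProgressions at h
      push Not at h
      obtain ⟨L, hL⟩ := h
      exact ⟨L, fun _ ↦ hL⟩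
  choose f hf using bad
  obtain ⟨k, hk, d, hd, hdk⟩ := step (Finset.univ.sup f)
  obtain ⟨i, hi, hif, hmem⟩ := hf k hk d hd
  exact hdk i hi (hif.trans (Finset.le_sup (Finset.mem_univ k))) hmem

/-- Logarithmic form of the exponential Schur theorem: for `n > 1` and every
finite coloring of ℕ there exist `a, b ≥ 1` with `a`, `b`, `a·n^b` monochromatic. -/
theorem log_exponential_schur (n : ℕ) (hn : 1 < n) (r : ℕ) (c : ℕ → Fin r) :
    ∃ a b : ℕ, 1 ≤ a ∧ 1 ≤ b ∧ c a = c b ∧ c a = c (a * n ^ b) := by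
  by_contra! hc
  have avoids (m : ℕ) : ∃ S : Finset (Fin r), S.card = m ∧ AvoidsHomogeneousProgressions c S := by
    induction m with
    | zero => exact ⟨∅, rfl, fun _ ↦ ⟨1, le_rfl, by simp⟩⟩
    | succ m ih =>
      obtain ⟨S, hm, hS⟩ := ih
      obtain ⟨k, hk, hkS⟩ := hS.exists_insert hn.le hc
      exact ⟨insert k S, by rw [Finset.card_insert_of_notMem hk, hm], hkS⟩
  obtain ⟨S, hS, -⟩ := avoids (r + 1)
  have h := Finset.card_le_univ S
  rw [Fintype.card_fin] at h
  omega
end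

section
/- Fix an integer n > 1. For every finite coloring of ℕ there exist a, b, x, y (all ≥ 1) of the same color such that x·y = a^b, where a = n^s and b = n^t for suitable s, t; more precisely, the equation x·y = a^b has a monochromatic solution {a, b, x, y} with a, b, x, y not all equal. -/
/-- Finite van der Waerden theorem, deduced from the Hales–Jewett theorem. -/
theorem exists_vanDerWaerden_bound (κ : Type) [Finite κ] (l : ℕ) :
    ∃ W : ℕ, ∀ C : ℕ → κ, ∃ k e : ℕ, 0 < e ∧ e ≤ W ∧ k + e * l ≤ W ∧
      ∀ i ≤ l, C (k + e * i) = C k := by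
  obtain ⟨ι, hι, h⟩ := Combinatorics.Line.exists_mono_in_high_dimension (Fin (l + 1)) κ
  refine ⟨Fintype.card ι * (l + 1), fun C => ?_⟩
  obtain ⟨L, col, hL⟩ := h fun f => C (∑ i, (f i : ℕ))
  classical
  set e := (Finset.univ.filter fun i => L.idxFun i = none).card with he
  set k := ∑ i, ((L 0 i : Fin (l + 1)) : ℕ) with hk
  have key : ∀ x : Fin (l + 1), ∑ i, ((L x i : Fin (l + 1)) : ℕ) = k + e * x := by
    intro x
    rw [hk, he, Finset.card_filter, Finset.sum_mul, ← Finset.sum_add_distrib]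
    refine Finset.sum_congr rfl fun i _ => ?_
    rcases hi : L.idxFun i with _ | y <;> simp [hi]
  have hmono : ∀ i ≤ l, C (k + e * i) = col := by
    intro i hi
    exact (congrArg C (key ⟨i, by omega⟩)).symm.trans (hL _)
  refine ⟨k, e, ?_, ?_, ?_, fun i hi => ?_⟩
  · obtain ⟨i, hi⟩ := L.proper
    exact Finset.card_pos.2 ⟨i, by simp [hi]⟩
  · exact (Finset.card_le_univ _).trans (Nat.le_mul_of_pos_right _ l.succ_pos)
  · have h1 := key (Fin.last l)
    rw [Fin.val_last] at h1
    rw [← h1]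
    calc ∑ i, ((L (Fin.last l) i : Fin (l + 1)) : ℕ) ≤ ∑ _i : ι, (l + 1) :=
          Finset.sum_le_sum fun i _ => (L (Fin.last l) i).is_lt.le
      _ = _ := by simp
  · rw [hmono i hi, ← hmono 0 (Nat.zero_le l), mul_zero, add_zero]

/-- Finite Schur theorem inside a homogeneous progression on which only the colors of `S` occur. -/
theorem exists_schur_bound_of_finset {κ : Type} [Finite κ] [DecidableEq κ] (S : Finset κ) :
    ∃ M : ℕ, ∀ (g : ℕ) (C : ℕ → κ), 0 < g → (∀ i, 1 ≤ i → i ≤ M → C (g * i) ∈ S) →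
      ∃ x y : ℕ, 0 < x ∧ 0 < y ∧ x + y ≤ g * M ∧ C x = C (x + y) ∧ C y = C (x + y) := by
  induction S using Finset.strongInduction with
  | H S ih =>
    choose! M hM using ih
    set l := S.sup fun A => M (S.erase A) with hl
    obtain ⟨W, hW⟩ := exists_vanDerWaerden_bound κ l
    refine ⟨W + l * W + 1, fun g C hg hS => ?_⟩
    obtain ⟨k, e, he, heW, hkW, hmono⟩ := hW fun i => C (g * (i + 1))
    set A := C (g * (k + 1)) with hA
    have hAS : A ∈ S := hS _ (by omega) (by nlinarith)
    by_cases hex : ∃ i, 1 ≤ i ∧ i ≤ l ∧ C (g * e * i) = A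
    · obtain ⟨i, hi, hil, hc⟩ := hex
      have hsum : g * (k + 1) + g * e * i = g * (k + e * i + 1) := by ring
      have hle : e * i ≤ e * l := Nat.mul_le_mul_left _ hil
      refine ⟨g * (k + 1), g * e * i, by positivity, by positivity, ?_, ?_, ?_⟩
      · rw [hsum]
        exact Nat.mul_le_mul_left _ (by nlinarith)
      · rw [hsum, hmono i hil]
      · rw [hsum, hmono i hil, hc]
    · push Not at hex
      have hle : M (S.erase A) ≤ l := Finset.le_sup (f := fun A => M (S.erase A)) hAS
      obtain ⟨x, y, hx, hy, hxy, h⟩ := hM (S.erase A) (Finset.erase_ssubset hAS) (g * e) C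
        (by positivity) fun i hi hiM => by
          refine Finset.mem_erase.2 ⟨hex i hi (hiM.trans hle), ?_⟩
          rw [mul_assoc]
          refine hS _ (Nat.mul_pos he hi) ?_
          have := Nat.mul_le_mul heW (hiM.trans hle)
          nlinarith
      refine ⟨x, y, hx, hy, hxy.trans ?_, h⟩
      rw [mul_assoc]
      refine Nat.mul_le_mul_left _ ?_
      have := Nat.mul_le_mul heW hle
      nlinarith

/-- Finite Schur theorem. -/
theorem exists_schur_bound (κ : Type) [Finite κ] :
    ∃ M : ℕ, ∀ C : ℕ → κ, ∃ x y : ℕ, 0 < x ∧ 0 < y ∧ x + y ≤ M ∧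
      C x = C (x + y) ∧ C y = C (x + y) := by
  classical
  have := Fintype.ofFinite κ
  obtain ⟨M, hM⟩ := exists_schur_bound_of_finset (Finset.univ : Finset κ)
  exact ⟨M, fun C => by simpa using hM 1 C one_pos (by simp)⟩

/-- If the numbers with colors in `S` form a multiplicatively thick set, then for each `l` some
homogeneous progression `d, 2d, …, ld` with colors in `S` consists of exponents `t` solving
`u + v = s * n ^ t` with `s, u, v` in one fixed color of `S`. -/
theorem exists_color_exponent_progression {n : ℕ} (hn : 1 < n) {κ : Type} [Finite κ]
    {C : ℕ → κ} {S : Finset κ}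
    (hS : ∀ l : ℕ, ∃ d, 2 ≤ d ∧ ∀ i, 1 ≤ i → i ≤ l → C (d * i) ∈ S) (l : ℕ) :
    ∃ A ∈ S, ∃ d, 2 ≤ d ∧ ∀ i, 1 ≤ i → i ≤ l → C (d * i) ∈ S ∧
      ∃ s u v : ℕ, 0 < s ∧ C s = A ∧ C u = A ∧ C v = A ∧ u + v = s * n ^ (d * i) := by
  obtain ⟨M, hM⟩ := exists_schur_bound κ
  obtain ⟨W, hW⟩ := exists_vanDerWaerden_bound (Fin (M + 1) → κ) l
  obtain ⟨D, hD, hDS⟩ := hS (W * l)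
  obtain ⟨B, hB, hBS⟩ := hS (M * n ^ (D * W))
  obtain ⟨k, e, he, heW, hkW, hmono⟩ := hW fun k j => C (B * (j * n ^ (D * k)))
  obtain ⟨x, y, hx, hy, hxy, hcx, hcy⟩ := hM fun j => C (B * (j * n ^ (D * k)))
  have hlevel : ∀ i ≤ l, ∀ j ≤ M,
      C (B * (j * n ^ (D * (k + e * i)))) = C (B * (j * n ^ (D * k))) := fun i hi j hj =>
    congrFun (hmono i hi) ⟨j, by omega⟩
  have hpos : ∀ m, 0 < n ^ m := fun m => Nat.pow_pos (by omega)
  refine ⟨C (B * ((x + y) * n ^ (D * k))), ?_, D * e, by nlinarith, fun i hi hil => ⟨?_, ?_⟩⟩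
  · refine hBS _ (Nat.mul_pos (by omega) (hpos _)) (Nat.mul_le_mul hxy ?_)
    exact Nat.pow_le_pow_right (by omega) (Nat.mul_le_mul_left _ (by omega))
  · rw [mul_assoc]
    exact hDS _ (Nat.mul_pos he hi) (Nat.mul_le_mul heW hil)
  · refine ⟨B * ((x + y) * n ^ (D * k)), B * (x * n ^ (D * (k + e * i))),
      B * (y * n ^ (D * (k + e * i))), ?_, rfl, ?_, ?_, ?_⟩
    · exact Nat.mul_pos (by omega) (Nat.mul_pos (by omega) (hpos _))
    · rw [hlevel i hil x (by omega), hcx]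
    · rw [hlevel i hil y (by omega), hcy]
    · rw [mul_add D, pow_add, mul_assoc D e i]
      ring

/-- The equation `u + v = s * n ^ t` has a monochromatic solution with `t ≥ 2` as soon as the
numbers with colors in `S` form a multiplicatively thick set. -/
theorem exists_mono_add_eq_mul_pow {n : ℕ} (hn : 1 < n) {κ : Type} [Finite κ] [DecidableEq κ]
    (C : ℕ → κ) (S : Finset κ)
    (hS : ∀ l : ℕ, ∃ d, 2 ≤ d ∧ ∀ i, 1 ≤ i → i ≤ l → C (d * i) ∈ S) :
    ∃ s t u v : ℕ, 0 < s ∧ 2 ≤ t ∧ C s = C t ∧ C s = C u ∧ C s = C v ∧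
      u + v = s * n ^ t := by
  induction S using Finset.strongInduction with
  | H S ih =>
    by_contra hno
    have hthin : ∀ A ∈ S, ∃ l : ℕ, ∀ d, 2 ≤ d → ∃ i, 1 ≤ i ∧ i ≤ l ∧ C (d * i) ∉ S.erase A := by
      intro A hA
      by_contra! h
      exact hno (ih _ (Finset.erase_ssubset hA) h)
    choose! L hL using hthin
    obtain ⟨A, hA, d, hd, h⟩ := exists_color_exponent_progression hn hS (S.sup L)
    obtain ⟨i, hi, hiL, hmem⟩ := hL A hA d hd
    obtain ⟨hCS, s, u, v, hs, hcs, hcu, hcv, heq⟩ := h i hi (hiL.trans (Finset.le_sup hA))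
    have hCA : C (d * i) = A := by
      by_contra hne
      exact hmem (Finset.mem_erase.2 ⟨hne, hCS⟩)
    exact hno ⟨s, d * i, u, v, hs, by nlinarith, by rw [hcs, hCA], by rw [hcs, hcu],
      by rw [hcs, hcv], heq⟩

/-- Partition regularity of the equation `x·y = a^b` with `a, b` powers of `n`:
a monochromatic solution `{a, b, x, y}`, not all equal. -/
theorem exponential_equals_product (n : ℕ) (hn : 1 < n) (r : ℕ) (c : ℕ → Fin r) :
    ∃ a b x y s t : ℕ, 1 ≤ a ∧ 1 ≤ b ∧ 1 ≤ x ∧ 1 ≤ y ∧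
      a = n ^ s ∧ b = n ^ t ∧
      c a = c b ∧ c a = c x ∧ c a = c y ∧
      x * y = a ^ b ∧ ¬(a = b ∧ b = x ∧ x = y) := by
  obtain ⟨s, t, u, v, hs, ht, hst, hsu, hsv, heq⟩ :=
    exists_mono_add_eq_mul_pow hn (fun k => c (n ^ k)) Finset.univ fun _ => ⟨2, le_rfl, by simp⟩
  have hpos : ∀ m, 1 ≤ n ^ m := fun m => Nat.pow_pos (by omega)
  refine ⟨n ^ s, n ^ t, n ^ u, n ^ v, s, t, hpos _, hpos _, hpos _, hpos _, rfl, rfl,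
    hst, hsu, hsv, ?_, ?_⟩
  · rw [← pow_add, heq, pow_mul]
  · rintro ⟨h1, h2, h3⟩
    have e1 := Nat.pow_right_injective hn h1
    have e2 := Nat.pow_right_injective hn h2
    have e3 := Nat.pow_right_injective hn h3
    have hsum : u + v = s * 2 := by omega
    have htwo : 2 = n ^ t := Nat.eq_of_mul_eq_mul_left hs (hsum.symm.trans heq)
    have hlt : t < n ^ t := Nat.lt_pow_self hn
    omega
end
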